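/- arXiv:2602.03061 — 3 statements merged into one kernel-verified Lean document; each statement's English description precedes it below -/
import Mathlib

section
/- (Closed-form outcome regression in the simulation model) Let X be a real-valued integrable random variable independent of the pair (ε, η), and set Y = X + ε, G = X, and W = X + ρ·ε + η. Then E[(Y − G)² | σ(X, W)] = (1 − κρ)σ² + κ²·(W − X)² almost everywhere, where σ(X, W) is the σ-algebra generated by X and W. -/
open MeasureTheory ProbabilityTheory

lemma indep_aux {Ω : Type*} {mΩ : MeasurableSpace Ω} {P : Measure Ω} [IsProbabilityMeasure P]
    {A B C : Ω → ℝ} (hA : Measurable A) (hB : Measurable B) (hC : Measurable C)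
    (h1 : IndepFun A (fun ω => (C ω, B ω)) P) (h2 : IndepFun C B P) :
    IndepFun (fun ω => (A ω, C ω)) B P := by
  have hAC : IndepFun A C P := h1.comp measurable_id measurable_fst
  have : IsProbabilityMeasure (P.map A) := Measure.isProbabilityMeasure_map hA.aemeasurable
  have : IsProbabilityMeasure (P.map B) := Measure.isProbabilityMeasure_map hB.aemeasurable
  have : IsProbabilityMeasure (P.map C) := Measure.isProbabilityMeasure_map hC.aemeasurable
  have e1 := (indepFun_iff_map_prod_eq_prod_map_map hA.aemeasurable
    (hC.prodMk hB).aemeasurable).1 h1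
  rw [(indepFun_iff_map_prod_eq_prod_map_map hC.aemeasurable hB.aemeasurable).1 h2] at e1
  rw [indepFun_iff_map_prod_eq_prod_map_map (hA.prodMk hC).aemeasurable hB.aemeasurable,
    (indepFun_iff_map_prod_eq_prod_map_map hA.aemeasurable hC.aemeasurable).1 hAC]
  apply MeasurableEquiv.prodAssoc.map_measurableEquiv_injective
  rw [Measure.prodAssoc_prod, ← e1, Measure.map_map (by fun_prop) (by fun_prop)]
  rfl

/-- (Closed-form outcome regression in the simulation model) With `Y = X + ε`, `G = X`,
`W = X + ρ·ε + η`, and `X` integrable and independent of `(ε, η)`, one has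
`E[(Y − G)² | σ(X, W)] = (1 − κρ)σ² + κ²·(W − X)²` a.e.,
where `κ = ρσ² / (ρ²σ² + σ_η²)`. -/
theorem simulation_outcome_regression
    {Ω : Type*} {mΩ : MeasurableSpace Ω} {P : Measure Ω} [IsProbabilityMeasure P]
    {ε η : Ω → ℝ} (hε : Measurable ε) (hη : Measurable η)
    (hindep : IndepFun ε η P)
    {σ ση : ℝ} (hσ : 0 < σ) (hση : 0 < ση)
    (hεlaw : P.map ε = gaussianReal 0 ⟨σ ^ 2, sq_nonneg σ⟩)
    (hηlaw : P.map η = gaussianReal 0 ⟨ση ^ 2, sq_nonneg ση⟩)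
    (ρ : ℝ)
    {X : Ω → ℝ} (hX : Measurable X) (hXint : Integrable X P)
    (hXindep : IndepFun X (fun ω => (ε ω, η ω)) P) :
    P[(fun ω => ((X ω + ε ω) - X ω) ^ 2) |
        MeasurableSpace.comap
          (fun ω => (X ω, X ω + (ρ * ε ω + η ω))) inferInstance]
      =ᵐ[P] fun ω =>
        (1 - (ρ * σ ^ 2 / (ρ ^ 2 * σ ^ 2 + ση ^ 2)) * ρ) * σ ^ 2
          + (ρ * σ ^ 2 / (ρ ^ 2 * σ ^ 2 + ση ^ 2)) ^ 2
            * ((X ω + (ρ * ε ω + η ω)) - X ω) ^ 2 := by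
  have hD : 0 < ρ ^ 2 * σ ^ 2 + ση ^ 2 := by positivity
  generalize hκ : ρ * σ ^ 2 / (ρ ^ 2 * σ ^ 2 + ση ^ 2) = κ
  have hκD : κ * (ρ ^ 2 * σ ^ 2 + ση ^ 2) = ρ * σ ^ 2 := by
    rw [← hκ]; field_simp
  have gl : ∀ {Z : Ω → ℝ} {v : NNReal}, P.map Z = gaussianReal 0 v → HasGaussianLaw Z P :=
    fun h => ⟨by rw [h]; infer_instance⟩
  have gε : HasGaussianLaw ε P := gl hεlaw
  have gη : HasGaussianLaw η P := gl hηlaw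
  have gj : HasGaussianLaw (fun ω => (ε ω, η ω)) P := hindep.hasGaussianLaw gε gη
  have mean : ∀ {Z : Ω → ℝ} {v : NNReal}, Measurable Z → P.map Z = gaussianReal 0 v →
      ∫ ω, Z ω ∂P = 0 := by
    intro Z v hZ h
    have := integral_map (μ := P) hZ.aemeasurable (f := fun x : ℝ => x)
      (by fun_prop)
    rw [← this, h, integral_id_gaussianReal]
  have var : ∀ {Z : Ω → ℝ} {v : NNReal}, Measurable Z → P.map Z = gaussianReal 0 v →
      ∫ ω, Z ω ^ 2 ∂P = v := by
    intro Z v hZ h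
    have h1 := variance_of_integral_eq_zero hZ.aemeasurable (mean hZ h)
    rw [← h1, ← variance_id_map hZ.aemeasurable, h, variance_id_gaussianReal]
  have mε := mean hε hεlaw
  have mη := mean hη hηlaw
  have vε : ∫ ω, ε ω ^ 2 ∂P = σ ^ 2 := var hε hεlaw
  have vη : ∫ ω, η ω ^ 2 ∂P = ση ^ 2 := var hη hηlaw
  have cεη : ∫ ω, ε ω * η ω ∂P = 0 := by
    rw [hindep.integral_fun_mul_eq_mul_integral hε.aestronglyMeasurable
      hη.aestronglyMeasurable, mε, zero_mul]
  have iε := gε.integrable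
  have iη := gη.integrable
  have iεε : Integrable (fun ω => ε ω ^ 2) P := gε.memLp_two.integrable_sq
  have iηη : Integrable (fun ω => η ω ^ 2) P := gη.memLp_two.integrable_sq
  have iεη : Integrable (fun ω => ε ω * η ω) P := gε.memLp_two.integrable_mul gη.memLp_two
  have quad : ∀ a b c : ℝ, ∫ ω, (a * ε ω ^ 2 + b * (ε ω * η ω) + c * η ω ^ 2) ∂P
      = a * σ ^ 2 + c * ση ^ 2 := by
    intro a b c
    rw [integral_add (by fun_prop) (by fun_prop), integral_add (by fun_prop) (by fun_prop),
      integral_const_mul, integral_const_mul, integral_const_mul, vε, vη, cεη]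
    ring
  obtain ⟨V, hV⟩ : ∃ V : Ω → ℝ, V = fun ω => ρ * ε ω + η ω := ⟨_, rfl⟩
  obtain ⟨U, hU⟩ : ∃ U : Ω → ℝ, U = fun ω => (1 - κ * ρ) * ε ω - κ * η ω := ⟨_, rfl⟩
  have mV : Measurable V := by rw [hV]; fun_prop
  have mU : Measurable U := by rw [hU]; fun_prop
  have gVU : HasGaussianLaw (fun ω => (V ω, U ω)) P := by
    let L : ℝ × ℝ →L[ℝ] ℝ × ℝ :=
      (ρ • ContinuousLinearMap.fst ℝ ℝ ℝ + ContinuousLinearMap.snd ℝ ℝ ℝ).prod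
      ((1 - κ * ρ) • ContinuousLinearMap.fst ℝ ℝ ℝ - κ • ContinuousLinearMap.snd ℝ ℝ ℝ)
    have := gj.map_fun L
    simpa [L, hU, hV] using this
  have gV := gVU.fst
  have gU := gVU.snd
  have EU : ∫ ω, U ω ∂P = 0 := by
    rw [hU, integral_sub (by fun_prop) (by fun_prop), integral_const_mul, integral_const_mul,
      mε, mη]; simp
  have EUU : ∫ ω, U ω ^ 2 ∂P = (1 - κ * ρ) * σ ^ 2 := by
    have := quad ((1 - κ * ρ) ^ 2) (-2 * (1 - κ * ρ) * κ) (κ ^ 2)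
    calc _ = _ := by congr 1; ext ω; rw [hU]; ring
      _ = _ := this
      _ = _ := by linear_combination κ * hκD
  have EVU : ∫ ω, V ω * U ω ∂P = 0 := by
    have := quad (ρ * (1 - κ * ρ)) (1 - κ * ρ - ρ * κ) (-κ)
    calc _ = _ := by congr 1; ext ω; rw [hU, hV]; ring
      _ = _ := this
      _ = _ := by linear_combination -hκD
  have hVU : IndepFun V U P := by
    apply gVU.indepFun_of_covariance_eq_zero
    rw [covariance_eq_sub gV.memLp_two gU.memLp_two, EU]
    simpa using EVU
  have hXVU : IndepFun X (fun ω => (V ω, U ω)) P := by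
    have := hXindep.comp (φ := id)
      (ψ := fun p : ℝ × ℝ => (ρ * p.1 + p.2, (1 - κ * ρ) * p.1 - κ * p.2))
      measurable_id (by fun_prop)
    rw [hU, hV]; exact this
  have hI : IndepFun (fun ω => (X ω, V ω)) U P := indep_aux hX mU mV hXVU hVU
  have hI2 : IndepFun U (fun ω => (X ω, X ω + (ρ * ε ω + η ω))) P := by
    have := (hI.comp (φ := fun p : ℝ × ℝ => (p.1, p.1 + p.2)) (ψ := id)
      (by fun_prop) measurable_id).symm
    rw [hV] at this; exact this
  generalize hm : MeasurableSpace.comap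
          (fun ω => (X ω, X ω + (ρ * ε ω + η ω))) inferInstance = m
  have hle : m ≤ mΩ := by
    rw [← hm]
    exact Measurable.comap_le (by fun_prop)
  have hInd : Indep (MeasurableSpace.comap U inferInstance) m P := by
    rw [← hm]; exact hI2
  have mVm : Measurable[m] V := by
    have h0 : Measurable[m] (fun ω => (X ω, X ω + (ρ * ε ω + η ω))) := by
      rw [← hm]; exact comap_measurable _
    have h1 : Measurable (fun p : ℝ × ℝ => p.2 - p.1) := by fun_prop
    have := h1.comp h0
    have e : V = (fun p : ℝ × ℝ => p.2 - p.1) ∘ (fun ω => (X ω, X ω + (ρ * ε ω + η ω))) := by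
      ext ω; simp [hV]
    rw [e]; exact this
  have cU : Measurable[MeasurableSpace.comap U inferInstance] U := comap_measurable U
  have c1 : P[U | m] =ᵐ[P] fun _ => ∫ ω, U ω ∂P :=
    condExp_indep_eq mU.comap_le hle cU.stronglyMeasurable hInd
  have c2 : P[fun ω => U ω ^ 2 | m] =ᵐ[P] fun _ => ∫ ω, U ω ^ 2 ∂P :=
    condExp_indep_eq mU.comap_le hle (cU.pow_const 2).stronglyMeasurable hInd
  have iUU : Integrable (fun ω => U ω ^ 2) P := gU.memLp_two.integrable_sq
  have iVV : Integrable (fun ω => κ ^ 2 * V ω ^ 2) P := gV.memLp_two.integrable_sq.const_mul _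
  have iVU : Integrable ((fun ω => 2 * κ * V ω) * U) P :=
    (gV.memLp_two.const_mul (2 * κ)).integrable_mul gU.memLp_two
  have c3 : P[(fun ω => 2 * κ * V ω) * U | m] =ᵐ[P] (fun ω => 2 * κ * V ω) * P[U | m] :=
    condExp_mul_of_stronglyMeasurable_left (mVm.const_mul _).stronglyMeasurable iVU gU.integrable
  have c4 : P[fun ω => κ ^ 2 * V ω ^ 2 | m] = fun ω => κ ^ 2 * V ω ^ 2 :=
    condExp_of_stronglyMeasurable hle ((mVm.pow_const 2).const_mul _).stronglyMeasurable iVV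
  have dec : (fun ω => ((X ω + ε ω) - X ω) ^ 2)
      = ((fun ω => U ω ^ 2) + (fun ω => 2 * κ * V ω) * U) + fun ω => κ ^ 2 * V ω ^ 2 := by
    ext ω; simp only [Pi.add_apply, Pi.mul_apply, hU, hV]; ring
  rw [dec]
  filter_upwards [condExp_add (iUU.add iVU) iVV m, condExp_add iUU iVU m, c1, c2, c3]
    with ω h1 h2 h3 h4 h5
  rw [h1, Pi.add_apply, h2, Pi.add_apply, h4, h5, Pi.mul_apply, h3, EU, EUU, c4, hV]
  ring
end

section
/- (One-step estimator variance in the simulation model) Var(ε² − ((1 − κρ)σ² + κ²·S²)) = 2σ⁴·(1 − (R²)²), where R² = ρ²σ² / (ρ²σ² + σ_η²); that is, the asymptotic variance of the one-step estimator equals the naive variance 2σ⁴ multiplied by the factor 1 − (R²)². -/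
open MeasureTheory ProbabilityTheory

lemma gm (v : NNReal) : ∫ x, x ^ 4 ∂(gaussianReal 0 v) = 3 * (v:ℝ) ^ 2 := by
  have h := iteratedDeriv_mgf_zero (X := id) (μ := gaussianReal 0 v) (by simp) 4
  rw [mgf_id_gaussianReal] at h
  have e : ∀ (p q : ℝ → ℝ), (∀ t, HasDerivAt p (q t) t) →
      deriv (fun t => p t * Real.exp (0 * t + v * t ^ 2 / 2)) =
        fun t => (q t + p t * (v * t)) * Real.exp (0 * t + v * t ^ 2 / 2) := by
    intro p q hp
    funext t
    have h1 : HasDerivAt (fun t : ℝ => 0 * t + v * t ^ 2 / 2) (v * t) t := by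
      have := ((hasDerivAt_id t).const_mul (0:ℝ)).add (((hasDerivAt_pow 2 t).const_mul (v:ℝ)).div_const 2)
      refine this.congr_deriv ?_
      simp
      ring
    refine ((hp t).mul h1.exp).deriv.trans ?_
    ring
  have e1 := e (fun _ => 1) (fun _ => 0) (fun t => hasDerivAt_const t 1)
  simp only [one_mul, zero_add] at e1
  have e2 := e (fun t => v * t) (fun t => v) (fun t => by simpa using (hasDerivAt_id t).const_mul (v:ℝ))
  have e3 := e (fun t => v + v * t * (v * t)) (fun t => 2 * v ^ 2 * t) (fun t => by
    have := ((hasDerivAt_pow 2 t).const_mul ((v:ℝ)^2)).const_add (v:ℝ)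
    have k : (fun t : ℝ => (v:ℝ) + v * t * (v * t)) = fun x => (v:ℝ) + (v:ℝ) ^ 2 * x ^ 2 := by
      funext t; ring
    rw [k]
    refine this.congr_deriv ?_
    norm_num
    ring)
  have e4 := e (fun t => 2 * v ^ 2 * t + (v + v * t * (v * t)) * (v * t)) (fun t => 3 * v ^ 2 + 3 * v ^ 3 * t ^ 2) (fun t => by
    have := ((hasDerivAt_pow 3 t).const_mul ((v:ℝ)^3)).add ((hasDerivAt_id t).const_mul (3 * (v:ℝ)^2))
    have k : (fun t : ℝ => 2 * (v:ℝ) ^ 2 * t + (v + v * t * (v * t)) * (v * t)) =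
        (fun y => (v:ℝ) ^ 3 * y ^ 3) + fun y => 3 * (v:ℝ) ^ 2 * id y := by
      funext t; simp; ring
    rw [k]
    refine this.congr_deriv ?_
    norm_num
    ring)
  simp only [zero_add, zero_mul] at e1 e2 e3 e4 h
  simp only [iteratedDeriv_succ, iteratedDeriv_zero] at h
  rw [e1, e2, e3, e4] at h
  simpa using h.symm

lemma gm2 (v : NNReal) : ∫ x, x ^ 2 ∂(gaussianReal 0 v) = (v:ℝ) := by
  have h := variance_fun_id_gaussianReal (μ := 0) (v := v)
  rw [variance_eq_integral (by fun_prop)] at h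
  simpa using h

lemma gi (v : NNReal) (n : ℕ) : Integrable (fun x => x ^ n) (gaussianReal 0 v) := by
  rcases Nat.eq_zero_or_pos n with rfl | hn
  · simp
  have := (memLp_id_gaussianReal (μ := 0) (v := v) (n : NNReal)).integrable_norm_pow hn.ne'
  refine (integrable_norm_iff (by fun_prop)).1 ?_
  simpa using this

lemma hadd {Ω : Type*} {mΩ : MeasurableSpace Ω} {P : Measure Ω} {f g : Ω → ℝ} {a b : ℝ}
    (hf : Integrable f P ∧ ∫ ω, f ω ∂P = a) (hg : Integrable g P ∧ ∫ ω, g ω ∂P = b) :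
    Integrable (fun ω => f ω + g ω) P ∧ ∫ ω, f ω + g ω ∂P = a + b :=
  ⟨hf.1.add hg.1, by rw [integral_add hf.1 hg.1, hf.2, hg.2]⟩

lemma hmul {Ω : Type*} {mΩ : MeasurableSpace Ω} {P : Measure Ω} {f : Ω → ℝ} {a : ℝ} (c : ℝ)
    (hf : Integrable f P ∧ ∫ ω, f ω ∂P = a) :
    Integrable (fun ω => c * f ω) P ∧ ∫ ω, c * f ω ∂P = c * a :=
  ⟨hf.1.const_mul c, by rw [integral_const_mul, hf.2]⟩

lemma hmono {Ω : Type*} {mΩ : MeasurableSpace Ω} {P : Measure Ω} 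
    {ε η : Ω → ℝ} (hε : Measurable ε) (hη : Measurable η)
    (hindep : IndepFun ε η P) {v w : NNReal}
    (hεlaw : P.map ε = gaussianReal 0 v) (hηlaw : P.map η = gaussianReal 0 w) (i j : ℕ) :
    Integrable (fun ω => ε ω ^ i * η ω ^ j) P ∧ ∫ ω, ε ω ^ i * η ω ^ j ∂P =
      (∫ x, x ^ i ∂(gaussianReal 0 v)) * ∫ x, x ^ j ∂(gaussianReal 0 w) := by
  have h : IndepFun (fun ω => ε ω ^ i) (fun ω => η ω ^ j) P :=
    hindep.comp (φ := fun x : ℝ => x ^ i) (ψ := fun x : ℝ => x ^ j) (by fun_prop) (by fun_prop)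
  have i1 : Integrable (fun ω => ε ω ^ i) P := by
    have := gi v i
    rw [← hεlaw] at this
    exact this.comp_measurable hε
  have i2 : Integrable (fun ω => η ω ^ j) P := by
    have := gi w j
    rw [← hηlaw] at this
    exact this.comp_measurable hη
  refine ⟨h.integrable_mul i1 i2, ?_⟩
  refine (h.integral_mul_eq_mul_integral i1.1 i2.1).trans ?_
  rw [← hεlaw, ← hηlaw, integral_map hε.aemeasurable (by fun_prop),
    integral_map hη.aemeasurable (by fun_prop)]


/-- (One-step estimator variance in the simulation model)
`Var(ε² − ((1 − κρ)σ² + κ²·S²)) = 2σ⁴·(1 − (R²)²)`, where `S = ρ·ε + η`,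
`κ = ρσ² / (ρ²σ² + σ_η²)`, and `R² = ρ²σ² / (ρ²σ² + σ_η²)`. -/
theorem one_step_estimator_variance_simulation
    {Ω : Type*} {mΩ : MeasurableSpace Ω} {P : Measure Ω} [IsProbabilityMeasure P]
    {ε η : Ω → ℝ} (hε : Measurable ε) (hη : Measurable η)
    (hindep : IndepFun ε η P)
    {σ ση : ℝ} (hσ : 0 < σ) (hση : 0 < ση)
    (hεlaw : P.map ε = gaussianReal 0 ⟨σ ^ 2, sq_nonneg σ⟩)
    (hηlaw : P.map η = gaussianReal 0 ⟨ση ^ 2, sq_nonneg ση⟩)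
    (ρ : ℝ) :
    variance
      (fun ω =>
        ε ω ^ 2 -
          ((1 - (ρ * σ ^ 2 / (ρ ^ 2 * σ ^ 2 + ση ^ 2)) * ρ) * σ ^ 2
            + (ρ * σ ^ 2 / (ρ ^ 2 * σ ^ 2 + ση ^ 2)) ^ 2 * (ρ * ε ω + η ω) ^ 2)) P
      = 2 * σ ^ 4 * (1 - (ρ ^ 2 * σ ^ 2 / (ρ ^ 2 * σ ^ 2 + ση ^ 2)) ^ 2) := by
  obtain ⟨v, hv, hε'⟩ : ∃ v : NNReal, (v : ℝ) = σ ^ 2 ∧ P.map ε = gaussianReal 0 v :=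
    ⟨_, rfl, hεlaw⟩
  obtain ⟨w, hw, hη'⟩ : ∃ w : NNReal, (w : ℝ) = ση ^ 2 ∧ P.map η = gaussianReal 0 w :=
    ⟨_, rfl, hηlaw⟩
  have M := hmono hε hη hindep hε' hη'
  have M' : ∀ i j c, (∫ x, x ^ i ∂(gaussianReal 0 v)) *
      (∫ x, x ^ j ∂(gaussianReal 0 w)) = c →
      Integrable (fun ω => ε ω ^ i * η ω ^ j) P ∧ ∫ ω, ε ω ^ i * η ω ^ j ∂P = c :=
    fun i j c h => ⟨(M i j).1, (M i j).2.trans h⟩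
  have T : ρ ^ 2 * σ ^ 2 + ση ^ 2 ≠ 0 := by positivity
  have g1 := fun v => integral_id_gaussianReal (μ := 0) (v := v)
  set κ := ρ * σ ^ 2 / (ρ ^ 2 * σ ^ 2 + ση ^ 2) with hκ
  set d := (1 - κ * ρ) * σ ^ 2 with hd
  have m20 := M' 2 0 (σ ^ 2) (by simp [gm2, hv, hw])
  have m02 := M' 0 2 (ση ^ 2) (by simp [gm2, hv, hw])
  have m11 := M' 1 1 ((0:ℝ)) (by simp [g1, hv, hw])
  have m31 := M' 3 1 ((0:ℝ)) (by simp [g1, hv, hw])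
  have m13 := M' 1 3 ((0:ℝ)) (by simp [g1, hv, hw])
  have m40 := M' 4 0 (3 * (σ ^ 2) ^ 2) (by simp [gm, hv, hw])
  have m04 := M' 0 4 (3 * (ση ^ 2) ^ 2) (by simp [gm, hv, hw])
  have m22 := M' 2 2 (σ ^ 2 * ση ^ 2) (by simp [gm2, hv, hw])
  have m00 : Integrable (fun _ : Ω => (1:ℝ)) P ∧ ∫ _, (1:ℝ) ∂P = 1 := by simp
  have mean := hadd (hadd (hadd (hmul (1 - κ ^ 2 * ρ ^ 2) m20) (hmul (-2 * κ ^ 2 * ρ) m11))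
    (hmul (-κ ^ 2) m02)) (hmul (-d) m00)
  rw [variance_eq_integral (by fun_prop)]
  have hm : ∫ ω, ε ω ^ 2 - (d + κ ^ 2 * (ρ * ε ω + η ω) ^ 2) ∂P =
      (1 - κ ^ 2 * ρ ^ 2) * σ ^ 2 - κ ^ 2 * ση ^ 2 - d := by
    refine Eq.trans ?_ (mean.2.trans (by ring))
    congr 1; funext ω; ring
  rw [hm]
  obtain ⟨a, ha⟩ : ∃ a, a = 1 - κ ^ 2 * ρ ^ 2 := ⟨_, rfl⟩
  obtain ⟨b, hb⟩ : ∃ b, b = -2 * κ ^ 2 * ρ := ⟨_, rfl⟩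
  obtain ⟨c, hc⟩ : ∃ c, c = -κ ^ 2 := ⟨_, rfl⟩
  obtain ⟨e, he⟩ : ∃ e, e = a * σ ^ 2 + c * ση ^ 2 := ⟨_, rfl⟩
  have sq := hadd (hadd (hadd (hadd (hadd (hadd (hadd (hadd (hmul (a ^ 2) m40)
    (hmul (b ^ 2 + 2 * a * c) m22)) (hmul (c ^ 2) m04)) (hmul (2 * a * b) m31))
    (hmul (2 * b * c) m13)) (hmul (-2 * e * a) m20)) (hmul (-2 * e * b) m11))
    (hmul (-2 * e * c) m02)) (hmul (e ^ 2) m00)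
  refine Eq.trans ?_ (sq.2.trans ?_)
  · congr 1; funext ω; rw [he, ha, hb, hc]; ring
  · rw [he, ha, hb, hc, hκ]; field_simp; ring
end

section
/- (Variance reduction ratio) Var(ε²) − Var(ε² − ((1 − κρ)σ² + κ²·S²)) = (R²)² · Var(ε²), where R² = ρ²σ² / (ρ²σ² + σ_η²); that is, the proportional variance reduction achieved by the one-step estimator over the naive estimator equals the square of the coefficient of determination R². -/
open MeasureTheory ProbabilityTheory

lemma aux_deriv (v : ℝ) (p p' : ℝ → ℝ) (hp : ∀ t, HasDerivAt p (p' t) t) :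
    deriv (fun t => p t * Real.exp (v * t ^ 2 / 2))
      = fun t => (p' t + p t * (v * t)) * Real.exp (v * t ^ 2 / 2) := by
  funext t
  have h1 : HasDerivAt (fun t : ℝ => v * t ^ 2 / 2) (v * t) t := by
    have := (((hasDerivAt_id t).pow 2).const_mul v).div_const 2
    convert! this using 1
    simp; ring
  have := (hp t).mul h1.exp
  refine (HasDerivAt.deriv this).trans ?_
  ring

lemma aux_moments {Ω : Type*} {mΩ : MeasurableSpace Ω} {P : Measure Ω} [IsProbabilityMeasure P]
    {X : Ω → ℝ} {v : NNReal} (hX : Measurable X) (h : P.map X = gaussianReal 0 v) :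
    (∀ n : ℕ, Integrable (fun ω => X ω ^ n) P) ∧ ∫ ω, X ω ^ 1 ∂P = 0 ∧ ∫ ω, X ω ^ 2 ∂P = v
      ∧ ∫ ω, X ω ^ 3 ∂P = 0 ∧ ∫ ω, X ω ^ 4 ∂P = 3 * (v : ℝ) ^ 2 := by
  have hset : (0 : ℝ) ∈ interior (integrableExpSet id (gaussianReal 0 v)) := by
    simp
  have hmap : ∀ n : ℕ, ∫ ω, X ω ^ n ∂P = iteratedDeriv n (mgf id (gaussianReal 0 v)) 0 := by
    intro n
    rw [iteratedDeriv_mgf_zero hset, ← h, integral_map hX.aemeasurable (by fun_prop)]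
    simp
  have hint : ∀ n : ℕ, Integrable (fun ω => X ω ^ n) P := by
    intro n
    have := integrable_pow_of_mem_interior_integrableExpSet hset n
    rw [← h, integrable_map_measure (by fun_prop) hX.aemeasurable] at this
    exact this
  have d0 : mgf id (gaussianReal 0 v) = fun t => 1 * Real.exp (v * t ^ 2 / 2) := by
    rw [mgf_id_gaussianReal]; simp
  have d1 : iteratedDeriv 1 (mgf id (gaussianReal 0 v))
      = fun t => (v * t) * Real.exp (v * t ^ 2 / 2) := by
    rw [iteratedDeriv_one, d0, aux_deriv v (fun _ => 1) (fun _ => 0) (fun t => hasDerivAt_const _ _)]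
    simp
  have d2 : iteratedDeriv 2 (mgf id (gaussianReal 0 v))
      = fun t => (v + v ^ 2 * t ^ 2) * Real.exp (v * t ^ 2 / 2) := by
    rw [iteratedDeriv_succ, d1, aux_deriv v (fun t => v * t) (fun _ => v)
      (fun t => by simpa using (hasDerivAt_id t).const_mul (v : ℝ))]
    funext t; ring
  have d3 : iteratedDeriv 3 (mgf id (gaussianReal 0 v))
      = fun t => (3 * v ^ 2 * t + v ^ 3 * t ^ 3) * Real.exp (v * t ^ 2 / 2) := by
    rw [iteratedDeriv_succ, d2, aux_deriv v (fun t => v + v ^ 2 * t ^ 2) (fun t => v ^ 2 * (2 * t))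
      (fun t => by simpa using ((hasDerivAt_pow 2 t).const_mul ((v : ℝ) ^ 2)).const_add (v : ℝ))]
    funext t; ring
  have d4 : iteratedDeriv 4 (mgf id (gaussianReal 0 v))
      = fun t => (3 * v ^ 2 + v ^ 3 * (3 * t ^ 2) + (3 * v ^ 2 * t + v ^ 3 * t ^ 3) * (v * t))
          * Real.exp (v * t ^ 2 / 2) := by
    rw [iteratedDeriv_succ, d3, aux_deriv v (fun t : ℝ => 3 * v ^ 2 * t + v ^ 3 * t ^ 3)
      (fun t : ℝ => 3 * v ^ 2 + v ^ 3 * (3 * t ^ 2))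
      (fun t => by
        simpa using ((hasDerivAt_id t).const_mul (3 * (v : ℝ) ^ 2)).fun_add
          ((hasDerivAt_pow 3 t).const_mul ((v : ℝ) ^ 3)))]
  refine ⟨hint, ?_, ?_, ?_, ?_⟩
  · rw [hmap, d1]; simp
  · rw [hmap, d2]; simp
  · rw [hmap, d3]; simp
  · rw [hmap, d4]; simp

lemma aux_variance {Ω : Type*} {mΩ : MeasurableSpace Ω} {P : Measure Ω} [IsProbabilityMeasure P]
    {X Y : Ω → ℝ} {s t : NNReal} (hX : Measurable X) (hY : Measurable Y)
    (hXY : IndepFun X Y P)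
    (hs : P.map X = gaussianReal 0 s) (ht : P.map Y = gaussianReal 0 t) (A B C : ℝ) :
    variance (fun ω => A * X ω ^ 2 + B * (X ω * Y ω) + C * Y ω ^ 2) P
      = 2 * A ^ 2 * s ^ 2 + B ^ 2 * s * t + 2 * C ^ 2 * t ^ 2 := by
  obtain ⟨iX, x1, x2, x3, x4⟩ := aux_moments hX hs
  obtain ⟨iY, y1, y2, y3, y4⟩ := aux_moments hY ht
  have hind : ∀ i j : ℕ, IndepFun (fun ω => X ω ^ i) (fun ω => Y ω ^ j) P := fun i j =>
    hXY.comp (φ := fun x => x ^ i) (ψ := fun x => x ^ j) (by fun_prop) (by fun_prop)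
  have hi : ∀ i j : ℕ, Integrable (fun ω => X ω ^ i * Y ω ^ j) P := fun i j =>
    (hind i j).integrable_mul (iX i) (iY j)
  have hm : ∀ i j : ℕ, ∫ ω, X ω ^ i * Y ω ^ j ∂P = (∫ ω, X ω ^ i ∂P) * ∫ ω, Y ω ^ j ∂P :=
    fun i j => (hind i j).integral_fun_mul_eq_mul_integral (iX i).1 (iY j).1
  have e1 : ∫ ω, (A * X ω ^ 2 + B * (X ω * Y ω) + C * Y ω ^ 2) ∂P = A * s + C * t := by
    have h11 := hm 1 1
    have i11 := hi 1 1
    rw [x1, y1] at h11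
    simp only [pow_one] at h11 i11
    rw [integral_add (((iX 2).const_mul A).fun_add (i11.const_mul B)) ((iY 2).const_mul C),
      integral_add ((iX 2).const_mul A) (i11.const_mul B)]
    simp only [integral_const_mul, h11, x2, y2]
    ring
  have hsq : (fun ω => (A * X ω ^ 2 + B * (X ω * Y ω) + C * Y ω ^ 2) ^ 2)
      = fun ω => A ^ 2 * X ω ^ 4 + 2 * A * B * (X ω ^ 3 * Y ω ^ 1)
        + (B ^ 2 + 2 * A * C) * (X ω ^ 2 * Y ω ^ 2) + 2 * B * C * (X ω ^ 1 * Y ω ^ 3)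
        + C ^ 2 * Y ω ^ 4 := by
    funext ω; ring
  have j1 := (iX 4).const_mul (A ^ 2)
  have j2 := (hi 3 1).const_mul (2 * A * B)
  have j3 := (hi 2 2).const_mul (B ^ 2 + 2 * A * C)
  have j4 := (hi 1 3).const_mul (2 * B * C)
  have j5 := (iY 4).const_mul (C ^ 2)
  have isq : Integrable (fun ω => (A * X ω ^ 2 + B * (X ω * Y ω) + C * Y ω ^ 2) ^ 2) P := by
    rw [hsq]
    exact (((j1.add j2).add j3).add j4).add j5
  have e2 : ∫ ω, (A * X ω ^ 2 + B * (X ω * Y ω) + C * Y ω ^ 2) ^ 2 ∂P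
      = 3 * A ^ 2 * s ^ 2 + (B ^ 2 + 2 * A * C) * (s * t) + 3 * C ^ 2 * t ^ 2 := by
    rw [hsq, integral_add (((j1.fun_add j2).fun_add j3).fun_add j4) j5,
      integral_add ((j1.fun_add j2).fun_add j3) j4, integral_add (j1.fun_add j2) j3, integral_add j1 j2]
    simp only [integral_const_mul, hm, x1, x2, x3, x4, y1, y2, y3, y4]
    ring
  have hL : MemLp (fun ω => A * X ω ^ 2 + B * (X ω * Y ω) + C * Y ω ^ 2) 2 P :=
    (memLp_two_iff_integrable_sq (by fun_prop)).2 isq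
  rw [variance_eq_sub hL, e1]
  simp only [Pi.pow_apply]
  rw [e2]
  ring

/-- (Variance reduction ratio)
`Var(ε²) − Var(ε² − ((1 − κρ)σ² + κ²·S²)) = (R²)² · Var(ε²)`, where `S = ρ·ε + η`,
`κ = ρσ² / (ρ²σ² + σ_η²)`, and `R² = ρ²σ² / (ρ²σ² + σ_η²)`. -/
theorem variance_reduction_ratio
    {Ω : Type*} {mΩ : MeasurableSpace Ω} {P : Measure Ω} [IsProbabilityMeasure P]
    {ε η : Ω → ℝ} (hε : Measurable ε) (hη : Measurable η)
    (hindep : IndepFun ε η P)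
    {σ ση : ℝ} (hσ : 0 < σ) (hση : 0 < ση)
    (hεlaw : P.map ε = gaussianReal 0 ⟨σ ^ 2, sq_nonneg σ⟩)
    (hηlaw : P.map η = gaussianReal 0 ⟨ση ^ 2, sq_nonneg ση⟩)
    (ρ : ℝ) :
    variance (fun ω => ε ω ^ 2) P
      - variance
          (fun ω =>
            ε ω ^ 2 -
              ((1 - (ρ * σ ^ 2 / (ρ ^ 2 * σ ^ 2 + ση ^ 2)) * ρ) * σ ^ 2
                + (ρ * σ ^ 2 / (ρ ^ 2 * σ ^ 2 + ση ^ 2)) ^ 2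
                  * (ρ * ε ω + η ω) ^ 2)) P
      = (ρ ^ 2 * σ ^ 2 / (ρ ^ 2 * σ ^ 2 + ση ^ 2)) ^ 2
          * variance (fun ω => ε ω ^ 2) P := by
  have hD : ρ ^ 2 * σ ^ 2 + ση ^ 2 ≠ 0 := by positivity
  have key : ∀ A B C : ℝ, variance (fun ω => A * ε ω ^ 2 + B * (ε ω * η ω) + C * η ω ^ 2) P
      = 2 * A ^ 2 * (σ ^ 2) ^ 2 + B ^ 2 * σ ^ 2 * ση ^ 2 + 2 * C ^ 2 * (ση ^ 2) ^ 2 :=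
    aux_variance hε hη hindep hεlaw hηlaw
  have h1 : variance (fun ω => ε ω ^ 2) P = 2 * (σ ^ 2) ^ 2 := by
    have := key 1 0 0
    simpa using this
  set κ := ρ * σ ^ 2 / (ρ ^ 2 * σ ^ 2 + ση ^ 2) with hκ
  have h2 : (fun ω => ε ω ^ 2 - ((1 - κ * ρ) * σ ^ 2 + κ ^ 2 * (ρ * ε ω + η ω) ^ 2))
      = fun ω => ((1 - κ ^ 2 * ρ ^ 2) * ε ω ^ 2 + (-2 * κ ^ 2 * ρ) * (ε ω * η ω)
        + (-κ ^ 2) * η ω ^ 2) - (1 - κ * ρ) * σ ^ 2 := by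
    funext ω; ring
  rw [h2, variance_sub_const (by fun_prop), key, h1]
  rw [hκ]
  field_simp
  ring
end
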